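/- Let C₁ > 0, 1 < b < 2 and ε > 0, and let f ∈ L¹(ℝ³) be nonnegative. Then the collision operator conserves particle number: ∫_{ℝ³} Q_ε(f,f)(p) d³p = 0. -/

import Mathlib

noncomputable section

open MeasureTheory Real Metric
open scoped RealInnerProductSpace

/-- Momentum space `ℝ³`. -/
abbrev R3 : Type := EuclideanSpace ℝ (Fin 3)

/-- The relative momentum `ρ(p,q) = √(2(|p||q| − p·q))`. -/
def relMom (p q : R3) : ℝ := Real.sqrt (2 * (‖p‖ * ‖q‖ - ⟪p, q⟫))

/-- Post-collision momentum `p'`. -/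
def pPost (p q ω : R3) : R3 :=
  (1 / 2 : ℝ) • (p + q) + (relMom p q / 2) • ω
    + (⟪p + q, ω⟫ / 2 / (‖p‖ + ‖q‖ + relMom p q)) • (p + q)

/-- Post-collision momentum `q'`. -/
def qPost (p q ω : R3) : R3 :=
  (1 / 2 : ℝ) • (p + q) - (relMom p q / 2) • ω
    - (⟪p + q, ω⟫ / 2 / (‖p‖ + ‖q‖ + relMom p q)) • (p + q)

/-- Post-collision energy `p'⁰`. -/
def p0Post (p q ω : R3) : ℝ := (‖p‖ + ‖q‖) / 2 + ⟪p + q, ω⟫ / 2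

/-- Post-collision energy `q'⁰`. -/
def q0Post (p q ω : R3) : ℝ := (‖p‖ + ‖q‖) / 2 - ⟪p + q, ω⟫ / 2

/-- The surface measure `dω` on the unit sphere `S² ⊂ ℝ³` (total mass `4π`). -/
def sphMeasure : Measure (sphere (0 : R3) 1) := (volume : Measure R3).toSphere

/-- The (modified, for `ε > 0`) massless Boltzmann collision operator with scattering
cross-section `σ = C₁ h^{-b}`. -/
def Qcoll (C₁ b ε : ℝ) (f : R3 → ℝ) (p : R3) : ℝ :=
  C₁ * ∫ q : R3, ∫ ω : sphere (0 : R3) 1,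
      (if ε ≤ relMom p q then relMom p q ^ (2 - b) / (‖p‖ * ‖q‖) else 0)
        * (f (pPost p q ω) * f (qPost p q ω) - f p * f q) ∂sphMeasure


def EE (P k : R3) : ℝ := Real.sqrt ((2 * ‖k‖) ^ 2 + ‖P‖ ^ 2)

def gg (P k : R3) : ℝ := ⟪P, k⟫ / (2 * ‖k‖ * (EE P k + 2 * ‖k‖))

def Lam (P k : R3) : R3 := k + gg P k • P

lemma EE_sq (P k : R3) : EE P k ^ 2 = (2 * ‖k‖) ^ 2 + ‖P‖ ^ 2 := by
  unfold EE; rw [Real.sq_sqrt]; positivity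

lemma EE_pos (P : R3) {k : R3} (hk : k ≠ 0) : 0 < EE P k := by
  unfold EE
  have := norm_pos_iff.2 hk
  positivity

lemma EE_gt (P : R3) {k : R3} (hk : k ≠ 0) : ‖P‖ < EE P k := by
  have := norm_pos_iff.2 hk
  have h := EE_sq P k
  have := EE_pos P hk
  apply lt_of_pow_lt_pow_left₀ 2 this.le
  rw [h]; nlinarith

lemma a_pos (P : R3) {k : R3} (hk : k ≠ 0) : 0 < EE P k / 2 + ⟪P, k⟫ / (2 * ‖k‖) := by
  have h0 := norm_pos_iff.2 hk
  have h := EE_gt P hk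
  have h1 := abs_real_inner_le_norm P k
  have h2 : -(‖P‖ / 2) ≤ ⟪P, k⟫ / (2 * ‖k‖) := by
    rw [le_div_iff₀ (by positivity)]
    have := neg_abs_le ⟪P, k⟫
    nlinarith
  linarith

lemma EE_neg (P k : R3) : EE P (-k) = EE P k := by simp [EE]

lemma Lam_neg (P k : R3) : Lam P (-k) = - Lam P k := by
  simp only [Lam, gg, EE_neg, norm_neg, inner_neg_right]
  module

lemma b_pos (P : R3) {k : R3} (hk : k ≠ 0) : 0 < EE P k / 2 - ⟪P, k⟫ / (2 * ‖k‖) := by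
  have := a_pos P (neg_ne_zero.2 hk)
  simp only [EE_neg, norm_neg, inner_neg_right] at this
  rw [neg_div] at this
  linarith

lemma norm_plus (P : R3) {k : R3} (hk : k ≠ 0) :
    ‖(1/2 : ℝ) • P + Lam P k‖ = EE P k / 2 + ⟪P, k⟫ / (2 * ‖k‖) := by
  have h0 := norm_pos_iff.2 hk
  have hE := EE_pos P hk
  have ha := a_pos P hk
  rw [← sq_eq_sq₀ (norm_nonneg _) ha.le]
  have : (1/2 : ℝ) • P + Lam P k = (1/2 + gg P k) • P + k := by unfold Lam; module
  rw [this, norm_add_sq_real, norm_smul, mul_pow, inner_smul_left, Real.norm_eq_abs, sq_abs]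
  have h2 := EE_sq P k
  have hP : ‖P‖ ^ 2 = EE P k ^ 2 - (2 * ‖k‖) ^ 2 := by linarith
  rw [hP]
  simp only [gg, conj_trivial]
  generalize EE P k = E at *
  generalize ⟪P, k⟫ = s at *
  generalize ‖k‖ = r at *
  field_simp
  ring

lemma norm_minus (P : R3) {k : R3} (hk : k ≠ 0) :
    ‖(1/2 : ℝ) • P - Lam P k‖ = EE P k / 2 - ⟪P, k⟫ / (2 * ‖k‖) := by
  have := norm_plus P (neg_ne_zero.2 hk)
  rw [Lam_neg, ← sub_eq_add_neg] at this
  rw [this, EE_neg, norm_neg, inner_neg_right]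
  ring

lemma relMom_eq (p q : R3) : relMom p q = Real.sqrt ((‖p‖ + ‖q‖) ^ 2 - ‖p + q‖ ^ 2) := by
  unfold relMom
  congr 1
  rw [norm_add_sq_real]; ring

lemma relMom_sq (p q : R3) : relMom p q ^ 2 = (‖p‖ + ‖q‖) ^ 2 - ‖p + q‖ ^ 2 := by
  rw [relMom_eq, Real.sq_sqrt]
  have := norm_add_le p q
  have := norm_nonneg (p + q)
  nlinarith

lemma add_half (P L : R3) : ((1/2 : ℝ) • P + L) + ((1/2 : ℝ) • P - L) = P := by module

lemma relMom_Lam (P : R3) {k : R3} (hk : k ≠ 0) :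
    relMom ((1/2 : ℝ) • P + Lam P k) ((1/2 : ℝ) • P - Lam P k) = 2 * ‖k‖ := by
  rw [relMom_eq, add_half, norm_plus P hk, norm_minus P hk]
  have h2 := EE_sq P k
  have : (EE P k / 2 + ⟪P, k⟫ / (2 * ‖k‖) + (EE P k / 2 - ⟪P, k⟫ / (2 * ‖k‖))) ^ 2 - ‖P‖ ^ 2
    = (2 * ‖k‖) ^ 2 := by ring_nf; ring_nf at h2; linarith
  rw [this, Real.sqrt_sq (by positivity)]

def psi (P L : R3) : R3 :=
  L - ((‖(1/2 : ℝ) • P + L‖ - ‖(1/2 : ℝ) • P - L‖) /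
    (2 * (‖(1/2 : ℝ) • P + L‖ + ‖(1/2 : ℝ) • P - L‖
      + relMom ((1/2 : ℝ) • P + L) ((1/2 : ℝ) • P - L)))) • P

lemma psi_Lam (P : R3) {k : R3} (hk : k ≠ 0) : psi P (Lam P k) = k := by
  have h0 := norm_pos_iff.2 hk
  have hE := EE_pos P hk
  unfold psi
  rw [relMom_Lam P hk, norm_plus P hk, norm_minus P hk]
  have : (EE P k / 2 + ⟪P, k⟫ / (2 * ‖k‖) - (EE P k / 2 - ⟪P, k⟫ / (2 * ‖k‖))) /
    (2 * (EE P k / 2 + ⟪P, k⟫ / (2 * ‖k‖) + (EE P k / 2 - ⟪P, k⟫ / (2 * ‖k‖)) + 2 * ‖k‖))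
     = gg P k := by
    unfold gg
    generalize EE P k = E at *
    generalize ⟪P, k⟫ = s at *
    generalize ‖k‖ = r at *
    rw [show (E / 2 + s / (2 * r) + (E / 2 - s / (2 * r)) + 2 * r) = E + 2 * r by ring]
    field_simp
    ring
  rw [this]; unfold Lam; module

lemma Lam_psi (P L : R3) (h : 0 < relMom ((1/2 : ℝ) • P + L) ((1/2 : ℝ) • P - L)) :
    psi P L ≠ 0 ∧ Lam P (psi P L) = L := by
  have e1 := relMom_sq ((1/2 : ℝ) • P + L) ((1/2 : ℝ) • P - L)
  rw [add_half] at e1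
  have ea : ‖(1/2 : ℝ) • P + L‖ ^ 2 = ‖P‖ ^ 2 / 4 + ⟪P, L⟫ + ‖L‖ ^ 2 := by
    rw [norm_add_sq_real, norm_smul, inner_smul_left]; simp; ring
  have eb : ‖(1/2 : ℝ) • P - L‖ ^ 2 = ‖P‖ ^ 2 / 4 - ⟪P, L⟫ + ‖L‖ ^ 2 := by
    rw [norm_sub_sq_real, norm_smul, inner_smul_left]; simp; ring
  have ha := norm_nonneg ((1/2 : ℝ) • P + L)
  have hb := norm_nonneg ((1/2 : ℝ) • P - L)
  obtain ⟨c, hc⟩ : ∃ c, c = (‖(1/2 : ℝ) • P + L‖ - ‖(1/2 : ℝ) • P - L‖) /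
    (2 * (‖(1/2 : ℝ) • P + L‖ + ‖(1/2 : ℝ) • P - L‖
      + relMom ((1/2 : ℝ) • P + L) ((1/2 : ℝ) • P - L))) := ⟨_, rfl⟩
  have hpsi : psi P L = L - c • P := by rw [hc]; rfl
  generalize relMom ((1/2 : ℝ) • P + L) ((1/2 : ℝ) • P - L) = r at *
  generalize ‖(1/2 : ℝ) • P + L‖ = a at *
  generalize ‖(1/2 : ℝ) • P - L‖ = b at *
  have hP : ‖P‖ ^ 2 = (a + b) ^ 2 - r ^ 2 := by linarith
  have hPL : ⟪P, L⟫ = (a ^ 2 - b ^ 2) / 2 := by linarith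
  have hL : ‖L‖ ^ 2 = ((a - b) ^ 2 + r ^ 2) / 4 := by nlinarith
  have hs : ⟪P, psi P L⟫ = r * (a - b) / 2 := by
    rw [hpsi, inner_sub_right, inner_smul_right, real_inner_self_eq_norm_sq, hP, hPL, hc]
    field_simp; ring
  have hk2 : ‖psi P L‖ ^ 2 = (r / 2) ^ 2 := by
    rw [hpsi, norm_sub_sq_real, norm_smul, mul_pow, inner_smul_right, real_inner_comm, hPL, hL,
      hP, Real.norm_eq_abs, sq_abs, hc]
    field_simp; ring
  have hk : ‖psi P L‖ = r / 2 := by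
    rwa [sq_eq_sq₀ (norm_nonneg _) (by positivity)] at hk2
  have hE : EE P (psi P L) = a + b := by
    unfold EE; rw [hk, hP, show (2 * (r/2))^2 + ((a+b)^2 - r^2) = (a+b)^2 by ring,
      Real.sqrt_sq (by positivity)]
  refine ⟨norm_pos_iff.1 (by rw [hk]; positivity), ?_⟩
  have : gg P (psi P L) = c := by
    unfold gg; rw [hE, hs, hk, hc]; field_simp; try ring
  unfold Lam
  rw [this, hpsi]; module

lemma pPost_eq (p q ω : R3) (hω : ‖ω‖ = 1) (h : 0 < relMom p q) :
    pPost p q ω = (1/2 : ℝ) • (p + q) + Lam (p + q) ((relMom p q / 2) • ω) ∧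
    qPost p q ω = (1/2 : ℝ) • (p + q) - Lam (p + q) ((relMom p q / 2) • ω) := by
  have e := relMom_sq p q
  have hE : EE (p + q) ((relMom p q / 2) • ω) = ‖p‖ + ‖q‖ := by
    unfold EE
    rw [norm_smul, hω, Real.norm_eq_abs, abs_of_pos (by positivity),
      show (2 * (relMom p q / 2 * 1)) ^ 2 = relMom p q ^ 2 by ring, e, sub_add_cancel,
      Real.sqrt_sq (by positivity)]
  have hg : gg (p + q) ((relMom p q / 2) • ω)
      = ⟪p + q, ω⟫ / 2 / (‖p‖ + ‖q‖ + relMom p q) := by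
    unfold gg
    rw [hE, norm_smul, hω, Real.norm_eq_abs, abs_of_pos (by positivity), inner_smul_right]
    have := norm_nonneg p
    have := norm_nonneg q
    field_simp
  unfold Lam pPost qPost
  rw [hg]
  constructor <;> module

lemma real_deriv (s r : ℝ → ℝ) (s0 r0 p E : ℝ) (hs0 : s 0 = s0) (hr0 : r 0 = r0) (h0 : 0 < r0)
    (hE : 0 < E) (hE2 : E ^ 2 = (2 * r0) ^ 2 + p ^ 2)
    (hs : HasDerivAt s (p ^ 2) 0) (hr : HasDerivAt r (s0 / r0) 0) :
    HasDerivAt (fun t => s t / (2 * r t * (Real.sqrt ((2 * r t) ^ 2 + p ^ 2) + 2 * r t)))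
      (4 * (E / 2 + s0 / (2 * r0)) * (E / 2 - s0 / (2 * r0)) / (2 * r0 * E) - 1) 0 := by
  have hEs : Real.sqrt ((2 * r0) ^ 2 + p ^ 2) = E := by
    rw [← hE2, Real.sqrt_sq hE.le]
  have h1 : HasDerivAt (fun t => (2 * r t) ^ 2 + p ^ 2) (8 * s0) 0 := by
    have := ((hr.const_mul 2).fun_pow 2).add_const (p^2)
    refine this.congr_deriv ?_
    rw [hr0]; field_simp; norm_num; ring
  have h2 : HasDerivAt (fun t => Real.sqrt ((2 * r t) ^ 2 + p ^ 2)) (4 * s0 / E) 0 := by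
    have := h1.sqrt (by rw [hr0]; positivity)
    refine this.congr_deriv ?_
    rw [hr0, hEs]; field_simp; ring
  have h3 := (hr.const_mul 2).fun_mul (h2.fun_add (hr.const_mul 2))
  have h4 := hs.fun_div h3 (by rw [hr0, hEs]; positivity)
  refine h4.congr_deriv ?_
  rw [hr0, hEs, hs0]
  have hP : p ^ 2 = E ^ 2 - (2 * r0) ^ 2 := by linarith
  rw [hP]
  field_simp
  ring

lemma gg_deriv (P : R3) {k : R3} (hk : k ≠ 0) :
    HasDerivAt (fun t : ℝ => gg P (k + t • P))
      (4 * (EE P k / 2 + ⟪P, k⟫ / (2 * ‖k‖)) * (EE P k / 2 - ⟪P, k⟫ / (2 * ‖k‖))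
        / (2 * ‖k‖ * EE P k) - 1) 0 := by
  have h0 := norm_pos_iff.2 hk
  have hE := EE_pos P hk
  have hl : HasDerivAt (fun t : ℝ => k + t • P) P 0 := by
    simpa using ((hasDerivAt_id (0:ℝ)).smul_const P).const_add k
  have hs : HasDerivAt (fun t : ℝ => ⟪P, k + t • P⟫) (‖P‖^2) 0 := by
    have := (hasDerivAt_const (0:ℝ) P).inner ℝ hl
    simpa using this
  have hn : HasDerivAt (fun t : ℝ => ‖k + t • P‖ ^ 2) (2 * ⟪P, k⟫) 0 := by
    have := hl.norm_sq
    simpa [real_inner_comm] using this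
  have hr : HasDerivAt (fun t : ℝ => ‖k + t • P‖) (⟪P, k⟫ / ‖k‖) 0 := by
    have := hn.sqrt (by simpa using hk)
    simp only [Real.sqrt_sq (norm_nonneg _)] at this
    convert this using 1
    simp
    field_simp
  exact real_deriv _ _ _ _ _ _ (by simp) (by simp) h0 hE (EE_sq P k) hs hr

lemma gg_diff (P : R3) {k : R3} (hk : k ≠ 0) : DifferentiableAt ℝ (gg P) k := by
  have h0 := norm_pos_iff.2 hk
  have hE := EE_pos P hk
  have hn : DifferentiableAt ℝ (fun k : R3 => ‖k‖) k := differentiableAt_id.norm ℝ hk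
  have hE' : DifferentiableAt ℝ (fun k => EE P k) k := by
    unfold EE
    refine DifferentiableAt.sqrt (((hn.const_mul 2).fun_pow 2).add_const _) ?_
    positivity
  have hden : 2 * ‖k‖ * (EE P k + 2 * ‖k‖) ≠ 0 := by positivity
  have hnum : DifferentiableAt ℝ (fun k : R3 => ⟪P, k⟫) k :=
    (differentiableAt_const P).inner ℝ differentiableAt_id
  have hd : DifferentiableAt ℝ (fun k : R3 => 2 * ‖k‖ * (EE P k + 2 * ‖k‖)) k :=
    (hn.const_mul 2).fun_mul (hE'.fun_add (hn.const_mul 2))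
  have h3 : DifferentiableAt ℝ (fun k : R3 => ⟪P, k⟫ * (2 * ‖k‖ * (EE P k + 2 * ‖k‖))⁻¹) k :=
    hnum.fun_mul (hd.fun_inv hden)
  have h4 : gg P = (fun k : R3 => ⟪P, k⟫ * (2 * ‖k‖ * (EE P k + 2 * ‖k‖))⁻¹) := by
    funext k; rw [gg, div_eq_mul_inv]
  rw [h4]; exact h3

lemma det_rank_one (φ : R3 →L[ℝ] ℝ) (v : R3) :
    (ContinuousLinearMap.id ℝ R3 + φ.smulRight v).det = 1 + φ v := by
  have h := LinearMap.det_toMatrix (EuclideanSpace.basisFun (Fin 3) ℝ).toBasis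
    ((ContinuousLinearMap.id ℝ R3 + φ.smulRight v : R3 →L[ℝ] R3) : R3 →ₗ[ℝ] R3)
  rw [ContinuousLinearMap.det, ← h]
  have hv : v = v 0 • EuclideanSpace.single 0 (1:ℝ) + v 1 • EuclideanSpace.single 1 (1:ℝ)
      + v 2 • EuclideanSpace.single 2 (1:ℝ) := by
    ext i; fin_cases i <;> simp
  have hφ : φ v = v 0 * φ (EuclideanSpace.single 0 (1:ℝ)) + v 1 * φ (EuclideanSpace.single 1 (1:ℝ))
      + v 2 * φ (EuclideanSpace.single 2 (1:ℝ)) := by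
    conv_lhs => rw [hv]
    simp only [map_add, map_smul, smul_eq_mul]
  rw [hφ, Matrix.det_fin_three]
  simp [LinearMap.toMatrix_apply]
  ring

def Jdet (P k : R3) : ℝ :=
  4 * (EE P k / 2 + ⟪P, k⟫ / (2 * ‖k‖)) * (EE P k / 2 - ⟪P, k⟫ / (2 * ‖k‖)) / (2 * ‖k‖ * EE P k)

lemma Lam_fderiv (P : R3) {k : R3} (hk : k ≠ 0) :
    HasFDerivAt (Lam P) (ContinuousLinearMap.id ℝ R3 + (fderiv ℝ (gg P) k).smulRight P) k ∧
    (ContinuousLinearMap.id ℝ R3 + (fderiv ℝ (gg P) k).smulRight P).det = Jdet P k := by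
  have hg := (gg_diff P hk).hasFDerivAt
  refine ⟨(hasFDerivAt_id k).add (hg.smul_const P), ?_⟩
  rw [det_rank_one]
  have h1 : HasDerivAt (fun t : ℝ => gg P (k + t • P)) (fderiv ℝ (gg P) k P) 0 := by
    have hl : HasDerivAt (fun t : ℝ => k + t • P) P 0 := by
      simpa using ((hasDerivAt_id (0:ℝ)).smul_const P).const_add k
    have hg' : HasFDerivAt (gg P) (fderiv ℝ (gg P) k) (k + (0:ℝ) • P) := by simpa using hg
    exact hg'.comp_hasDerivAt 0 hl
  rw [h1.unique (gg_deriv P hk), Jdet]; ring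

open scoped ENNReal

/-- change of variables for fixed total momentum -/
lemma cov (P : R3) (w : ℝ → ℝ) (hw0 : ∀ r, r ≤ 0 → w r = 0)
    (H : R3 × R3 → ℝ≥0∞) :
    ∫⁻ L : R3, ENNReal.ofReal (w (relMom ((1/2 : ℝ) • P + L) ((1/2 : ℝ) • P - L)) /
        (‖(1/2 : ℝ) • P + L‖ * ‖(1/2 : ℝ) • P - L‖)) *
        H ((1/2 : ℝ) • P + L, (1/2 : ℝ) • P - L) =
    ∫⁻ k in ({0}ᶜ : Set R3), ENNReal.ofReal (4 * w (2 * ‖k‖) / (2 * ‖k‖ * EE P k)) *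
        H ((1/2 : ℝ) • P + Lam P k, (1/2 : ℝ) • P - Lam P k) := by
  have hinj : Set.InjOn (Lam P) ({0}ᶜ : Set R3) := by
    intro x hx y hy hxy
    rw [← psi_Lam P (k := x) (by simpa using hx), hxy, psi_Lam P (k := y) (by simpa using hy)]
  have key := lintegral_image_eq_lintegral_abs_det_fderiv_mul (volume : Measure R3)
    (measurableSet_singleton (0:R3)).compl
    (fun x hx => (Lam_fderiv P (k := x) (by simpa using hx)).1.hasFDerivWithinAt) hinj
    (fun L => ENNReal.ofReal (w (relMom ((1/2 : ℝ) • P + L) ((1/2 : ℝ) • P - L)) /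
        (‖(1/2 : ℝ) • P + L‖ * ‖(1/2 : ℝ) • P - L‖)) *
        H ((1/2 : ℝ) • P + L, (1/2 : ℝ) • P - L))
  rw [setLIntegral_eq_of_support_subset] at key
  · rw [key]
    refine setLIntegral_congr_fun (measurableSet_singleton (0:R3)).compl fun k hk => ?_
    have hk : k ≠ 0 := by simpa using hk
    have h0 := norm_pos_iff.2 hk
    have hE := EE_pos P hk
    have ha := a_pos P hk
    have hb := b_pos P hk
    simp only
    rw [(Lam_fderiv P hk).2, relMom_Lam P hk, norm_plus P hk, norm_minus P hk, ← mul_assoc,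
      ← ENNReal.ofReal_mul (abs_nonneg _)]
    have hJ : 0 < Jdet P k := by unfold Jdet; positivity
    rw [abs_of_pos hJ]
    congr 2
    unfold Jdet
    generalize EE P k / 2 + ⟪P, k⟫ / (2 * ‖k‖) = a at *
    generalize EE P k / 2 - ⟪P, k⟫ / (2 * ‖k‖) = b at *
    field_simp
  · intro L hL
    have hr : 0 < relMom ((1/2 : ℝ) • P + L) ((1/2 : ℝ) • P - L) := by
      by_contra hcon
      apply hL
      simp only [hw0 _ (not_lt.1 hcon), zero_div, ENNReal.ofReal_zero, zero_mul]
    obtain ⟨h1, h2⟩ := Lam_psi P L hr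
    exact ⟨psi P L, by simpa using h1, h2⟩

lemma EE_cont (P : R3) : Continuous (EE P) := by unfold EE; fun_prop

lemma gg_meas (P : R3) : Measurable (gg P) := by
  have := (EE_cont P).measurable
  unfold gg
  have h : Measurable fun k : R3 => ⟪P, k⟫ := (by fun_prop : Continuous fun k : R3 => ⟪P, k⟫).measurable
  fun_prop

lemma Lam_meas (P : R3) : Measurable (Lam P) := by
  have := gg_meas P
  unfold Lam
  fun_prop

lemma relMom_cont : Continuous (fun x : R3 × R3 => relMom x.1 x.2) := by
  unfold relMom; fun_prop

lemma post_meas : Measurable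
    (fun x : (R3 × R3) × sphere (0 : R3) 1 =>
      ((pPost x.1.1 x.1.2 x.2, qPost x.1.1 x.1.2 x.2) : R3 × R3)) := by
  have h1 : Measurable (fun x : (R3 × R3) × sphere (0 : R3) 1 => relMom x.1.1 x.1.2) :=
    (relMom_cont.comp continuous_fst).measurable
  have h2 : Measurable (fun x : (R3 × R3) × sphere (0 : R3) 1 => ⟪x.1.1 + x.1.2, (x.2 : R3)⟫) :=
    (by fun_prop : Continuous
      (fun x : (R3 × R3) × sphere (0 : R3) 1 => ⟪x.1.1 + x.1.2, (x.2 : R3)⟫)).measurable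
  have h3 : Measurable (fun x : (R3 × R3) × sphere (0 : R3) 1 => (x.2 : R3)) := by fun_prop
  unfold pPost qPost
  fun_prop

lemma polar (G : R3 → ℝ≥0∞) (hG : Measurable G) :
    ∫⁻ k in ({0}ᶜ : Set R3), G k =
      ∫⁻ r : Set.Ioi (0:ℝ), ∫⁻ ω : sphere (0 : R3) 1, G (r.1 • ω.1) ∂sphMeasure
        ∂(Measure.volumeIoiPow (Module.finrank ℝ R3 - 1)) := by
  have hmp := (volume : Measure R3).measurePreserving_homeomorphUnitSphereProd
  have h1 := hmp.lintegral_comp_emb (Homeomorph.measurableEmbedding _)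
    (fun y => G (y.2.1 • y.1.1))
  rw [← lintegral_subtype_comap (measurableSet_singleton (0:R3)).compl]
  rw [lintegral_prod_symm _ (by fun_prop)] at h1
  rw [sphMeasure, ← h1]
  refine lintegral_congr fun x => ?_
  have : ((homeomorphUnitSphereProd R3 x).2.1 • (homeomorphUnitSphereProd R3 x).1.1) = x.1 := by
    have hx : ‖x.1‖ ≠ 0 := norm_ne_zero_iff.2 x.2
    simp [smul_smul, hx]
  rw [this]

instance : IsFiniteMeasure sphMeasure := by unfold sphMeasure; infer_instance

lemma fixedP (P : R3) (w : ℝ → ℝ) (hwm : Measurable w) (hw0 : ∀ r, r ≤ 0 → w r = 0)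
    (F : R3 × R3 → ℝ≥0∞) (hF : Measurable F) :
    ∫⁻ L : R3, ENNReal.ofReal (w (relMom ((1/2 : ℝ) • P + L) ((1/2 : ℝ) • P - L)) /
        (‖(1/2 : ℝ) • P + L‖ * ‖(1/2 : ℝ) • P - L‖)) *
        ∫⁻ ω : sphere (0 : R3) 1, F (pPost ((1/2 : ℝ) • P + L) ((1/2 : ℝ) • P - L) ω,
          qPost ((1/2 : ℝ) • P + L) ((1/2 : ℝ) • P - L) ω) ∂sphMeasure =
    ∫⁻ L : R3, ENNReal.ofReal (w (relMom ((1/2 : ℝ) • P + L) ((1/2 : ℝ) • P - L)) /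
        (‖(1/2 : ℝ) • P + L‖ * ‖(1/2 : ℝ) • P - L‖)) *
        ∫⁻ _ω : sphere (0 : R3) 1, F ((1/2 : ℝ) • P + L, (1/2 : ℝ) • P - L) ∂sphMeasure := by
  have hE := (EE_cont P).measurable
  have hL := Lam_meas P
  have hH : Measurable (fun x : R3 × R3 =>
      ∫⁻ ω : sphere (0 : R3) 1, F (pPost x.1 x.2 ω, qPost x.1 x.2 ω) ∂sphMeasure) :=
    (hF.comp post_meas).lintegral_prod_right'
  have hH2 : Measurable (fun x : R3 × R3 =>
      ∫⁻ _ω : sphere (0 : R3) 1, F x ∂sphMeasure) :=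
    (hF.comp measurable_fst).lintegral_prod_right'
  have hD : Measurable fun k : R3 => ENNReal.ofReal (4 * w (2 * ‖k‖) / (2 * ‖k‖ * EE P k)) := by
    fun_prop
  have hPhi : Measurable fun k : R3 => ((1/2 : ℝ) • P + Lam P k, (1/2 : ℝ) • P - Lam P k) := by
    fun_prop
  rw [cov P w hw0 (fun x : R3 × R3 =>
      ∫⁻ ω : sphere (0 : R3) 1, F (pPost x.1 x.2 ω, qPost x.1 x.2 ω) ∂sphMeasure),
    cov P w hw0 (fun x : R3 × R3 => ∫⁻ _ω : sphere (0 : R3) 1, F x ∂sphMeasure)]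
  refine (polar _ (hD.mul (hH.comp hPhi))).trans
    (Eq.trans ?_ (polar _ (hD.mul (hH2.comp hPhi))).symm)
  refine lintegral_congr fun r => ?_
  have hr : 0 < r.1 := r.2
  have hnorm : ∀ ω : sphere (0 : R3) 1, ‖r.1 • ω.1‖ = r.1 := by
    intro ω; rw [norm_smul]; simp [abs_of_pos hr]
  have hne : ∀ ω : sphere (0 : R3) 1, r.1 • ω.1 ≠ 0 := by
    intro ω; rw [← norm_pos_iff, hnorm]; exact hr
  have hEr : ∀ ω : sphere (0 : R3) 1, EE P (r.1 • ω.1) = Real.sqrt ((2 * r.1)^2 + ‖P‖^2) := by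
    intro ω; rw [EE, hnorm]
  have hpost : ∀ ω ω' : sphere (0 : R3) 1,
      pPost ((1/2 : ℝ) • P + Lam P (r.1 • ω.1)) ((1/2 : ℝ) • P - Lam P (r.1 • ω.1)) ω' =
        (1/2 : ℝ) • P + Lam P (r.1 • ω'.1) ∧
      qPost ((1/2 : ℝ) • P + Lam P (r.1 • ω.1)) ((1/2 : ℝ) • P - Lam P (r.1 • ω.1)) ω' =
        (1/2 : ℝ) • P - Lam P (r.1 • ω'.1) := by
    intro ω ω'
    have hrm := relMom_Lam P (hne ω)
    rw [hnorm] at hrm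
    have := pPost_eq ((1/2 : ℝ) • P + Lam P (r.1 • ω.1)) ((1/2 : ℝ) • P - Lam P (r.1 • ω.1)) ω'.1
      (by simp) (by rw [hrm]; positivity)
    rwa [add_half, hrm, mul_div_cancel_left₀ _ (two_ne_zero)] at this
  simp only [hnorm, hEr, Pi.mul_apply, Function.comp_apply, (hpost _ _).1, (hpost _ _).2]
  simp only [lintegral_const]
  have hFm : Measurable fun ω : sphere (0 : R3) 1 =>
      F ((1/2 : ℝ) • P + Lam P (r.1 • ω.1), (1/2 : ℝ) • P - Lam P (r.1 • ω.1)) := by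
    have : Measurable fun ω : sphere (0 : R3) 1 => r.1 • ω.1 := by fun_prop
    exact (hF.comp hPhi).comp this
  rw [lintegral_const_mul _ (hFm.mul_const _), lintegral_mul_const _ hFm, mul_assoc]

lemma shear (F : R3 × R3 → ℝ≥0∞) (hF : Measurable F) :
    ∫⁻ x : R3 × R3, F x = ∫⁻ P : R3, ∫⁻ L : R3, F ((1/2 : ℝ) • P + L, (1/2 : ℝ) • P - L) := by
  rw [Measure.volume_eq_prod, lintegral_prod _ hF.aemeasurable]
  have h1 : ∀ p : R3, ∫⁻ q, F (p, q) = ∫⁻ P, F (p, P - p) := fun p =>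
    (lintegral_sub_right_eq_self (fun q => F (p, q)) p).symm
  simp_rw [h1]
  rw [lintegral_lintegral_swap (by fun_prop)]
  refine lintegral_congr fun P => ?_
  rw [← lintegral_add_left_eq_self _ ((1/2 : ℝ) • P)]
  refine lintegral_congr fun L => ?_
  congr 2
  module

def wt (b ε r : ℝ) : ℝ := if ε ≤ r then r ^ (2 - b) else 0

lemma wt_meas (b ε : ℝ) : Measurable (wt b ε) := by
  unfold wt
  exact Measurable.ite measurableSet_Ici (by fun_prop) measurable_const

def WW (b ε : ℝ) (x : R3 × R3) : ℝ := wt b ε (relMom x.1 x.2) / (‖x.1‖ * ‖x.2‖)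

lemma WW_meas (b ε : ℝ) : Measurable (WW b ε) := by
  have := (wt_meas b ε).comp relMom_cont.measurable
  unfold WW
  exact this.div (by fun_prop)

lemma relMom_nonneg (p q : R3) : 0 ≤ relMom p q := Real.sqrt_nonneg _

lemma wt_nonneg (b : ℝ) {ε : ℝ} (hε : 0 < ε) (r : ℝ) : 0 ≤ wt b ε r := by
  unfold wt; split_ifs with h
  · exact Real.rpow_nonneg (by linarith) _
  · rfl

lemma WW_nonneg (b : ℝ) {ε : ℝ} (hε : 0 < ε) (x : R3 × R3) : 0 ≤ WW b ε x := by
  unfold WW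
  have := wt_nonneg b hε (relMom x.1 x.2)
  positivity

lemma WW_bdd (b : ℝ) {ε : ℝ} (hb : 1 < b) (hε : 0 < ε) (x : R3 × R3) :
    WW b ε x ≤ 4 * ε ^ (-b) := by
  unfold WW wt
  split_ifs with h
  · have hr : 0 < relMom x.1 x.2 := hε.trans_le h
    have h2 : relMom x.1 x.2 ^ 2 ≤ 4 * (‖x.1‖ * ‖x.2‖) := by
      unfold relMom
      have := neg_abs_le ⟪x.1, x.2⟫
      have := abs_real_inner_le_norm x.1 x.2
      have := real_inner_le_norm x.1 x.2
      rw [Real.sq_sqrt (by linarith)]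
      linarith
    have h3 : 0 < ‖x.1‖ * ‖x.2‖ := by nlinarith [pow_pos hr 2]
    have h4 : relMom x.1 x.2 ^ (2 - b) = relMom x.1 x.2 ^ 2 * relMom x.1 x.2 ^ (-b) := by
      rw [sub_eq_add_neg, Real.rpow_add hr, Real.rpow_two]
    have h5 : relMom x.1 x.2 ^ (-b) ≤ ε ^ (-b) :=
      Real.rpow_le_rpow_of_nonpos hε h (by linarith)
    rw [div_le_iff₀ h3, h4]
    have h6 : 0 ≤ relMom x.1 x.2 ^ (-b) := Real.rpow_nonneg hr.le _
    calc _ ≤ 4 * (‖x.1‖ * ‖x.2‖) * ε ^ (-b) := by gcongr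
      _ = _ := by ring
  · simp; positivity

def colMeas (b ε : ℝ) : Measure ((R3 × R3) × sphere (0 : R3) 1) :=
  ((volume : Measure (R3 × R3)).prod sphMeasure).withDensity
    (fun x => ((WW b ε x.1).toNNReal : ℝ≥0∞))


lemma map_eq (b : ℝ) {ε : ℝ} (hε : 0 < ε) :
    (colMeas b ε).map (fun x => (pPost x.1.1 x.1.2 x.2, qPost x.1.1 x.1.2 x.2)) =
      (colMeas b ε).map Prod.fst := by
  have hW := WW_meas b ε
  refine Measure.ext_of_lintegral _ fun F hF => ?_
  have hF1 : Measurable fun x : (R3 × R3) × sphere (0 : R3) 1 =>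
    F (pPost x.1.1 x.1.2 x.2, qPost x.1.1 x.1.2 x.2) := hF.comp post_meas
  have hF2 : Measurable fun x : (R3 × R3) × sphere (0 : R3) 1 => F x.1 := by fun_prop
  have hd : Measurable (fun x : (R3 × R3) × sphere (0 : R3) 1 =>
    ((WW b ε x.1).toNNReal : ℝ≥0∞)) := by fun_prop
  have hH : Measurable (fun x : R3 × R3 =>
      ∫⁻ ω : sphere (0 : R3) 1, F (pPost x.1 x.2 ω, qPost x.1 x.2 ω) ∂sphMeasure) :=
    hF1.lintegral_prod_right'
  have hH2 : Measurable (fun x : R3 × R3 =>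
      ∫⁻ _ω : sphere (0 : R3) 1, F x ∂sphMeasure) :=
    (hF.comp measurable_fst).lintegral_prod_right'
  have hWe : Measurable (fun x : R3 × R3 => ((WW b ε x).toNNReal : ℝ≥0∞)) := by fun_prop
  rw [lintegral_map hF post_meas, lintegral_map hF measurable_fst, colMeas,
    lintegral_withDensity_eq_lintegral_mul _ hd hF1,
    lintegral_withDensity_eq_lintegral_mul _ hd hF2,
    lintegral_prod _ (hd.mul hF1).aemeasurable, lintegral_prod _ (hd.mul hF2).aemeasurable]
  have e1 : ∀ x : R3 × R3, ∫⁻ ω : sphere (0 : R3) 1, ((WW b ε x).toNNReal : ℝ≥0∞) *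
      F (pPost x.1 x.2 ω, qPost x.1 x.2 ω) ∂sphMeasure = ((WW b ε x).toNNReal : ℝ≥0∞) *
      ∫⁻ ω : sphere (0 : R3) 1, F (pPost x.1 x.2 ω, qPost x.1 x.2 ω) ∂sphMeasure := by
    intro x
    rw [lintegral_const_mul' _ _ ENNReal.coe_ne_top]
  have e2 : ∀ x : R3 × R3, ∫⁻ _ω : sphere (0 : R3) 1, ((WW b ε x).toNNReal : ℝ≥0∞) *
      F x ∂sphMeasure = ((WW b ε x).toNNReal : ℝ≥0∞) *
      ∫⁻ _ω : sphere (0 : R3) 1, F x ∂sphMeasure := by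
    intro x
    rw [lintegral_const_mul _ measurable_const]
  simp only [Pi.mul_apply, Function.comp_apply]
  simp_rw [e1, e2]
  rw [shear _ (hWe.fun_mul hH), shear _ (hWe.fun_mul hH2)]
  refine lintegral_congr fun P => ?_
  have hw0 : ∀ r, r ≤ 0 → wt b ε r = 0 := by
    intro r hr
    unfold wt
    rw [if_neg (by linarith)]
  have hfin := fixedP P (wt b ε) (wt_meas b ε) hw0 F hF
  simp only [WW]
  exact hfin

/-- The collision operator conserves particle number: `∫ Q_ε(f,f) d³p = 0` for
nonnegative `f ∈ L¹(ℝ³)`. -/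
theorem Qcoll_integral_zero (C₁ b ε : ℝ) (hC₁ : 0 < C₁) (hb1 : 1 < b) (hb2 : b < 2)
    (hε : 0 < ε) (f : R3 → ℝ) (hf : Integrable f) (hfpos : ∀ᵐ p : R3, 0 ≤ f p) :
    ∫ p : R3, Qcoll C₁ b ε f p = 0 := by
  have hW := WW_meas b ε
  set ν : Measure ((R3 × R3) × sphere (0 : R3) 1) := (volume : Measure (R3 × R3)).prod sphMeasure
    with hν
  have hd : Measurable (fun x : (R3 × R3) × sphere (0 : R3) 1 => (WW b ε x.1).toNNReal) := by
    fun_prop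
  have hff : Integrable (fun x : R3 × R3 => f x.1 * f x.2) := hf.mul_prod hf
  have hsm : ∀ (x : R3 × R3) (y : ℝ), (WW b ε x).toNNReal • y = WW b ε x * y := by
    intro x y
    rw [NNReal.smul_def, Real.coe_toNNReal _ (WW_nonneg b hε x), smul_eq_mul]
  -- the loss term
  have hB : Integrable (fun x : (R3 × R3) × sphere (0 : R3) 1 => f x.1.1 * f x.1.2)
      (colMeas b ε) := by
    rw [colMeas, integrable_withDensity_iff_integrable_smul hd]
    simp only [hsm]
    refine Integrable.bdd_mul (c := 4 * ε ^ (-b)) (hff.comp_fst sphMeasure)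
      (hW.comp measurable_fst).aestronglyMeasurable (Filter.Eventually.of_forall fun x => ?_)
    rw [Real.norm_eq_abs, abs_of_nonneg (WW_nonneg b hε _)]
    exact WW_bdd b hb1 hε _
  have hac : (colMeas b ε).map Prod.fst ≪ (volume : Measure (R3 × R3)) := by
    have h1 : colMeas b ε ≪ ν := withDensity_absolutelyContinuous _ _
    exact (h1.map measurable_fst).trans Measure.quasiMeasurePreserving_fst.absolutelyContinuous
  have hsm1 : AEStronglyMeasurable (fun x : R3 × R3 => f x.1 * f x.2)
      ((colMeas b ε).map Prod.fst) := hff.1.mono_ac hac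
  have hB' : Integrable (fun x : R3 × R3 => f x.1 * f x.2) ((colMeas b ε).map Prod.fst) :=
    (integrable_map_measure hsm1 measurable_fst.aemeasurable).2 hB
  have hA' := hB'
  have hsm2 := hsm1
  rw [← map_eq b hε] at hA' hsm2
  have hA := (integrable_map_measure hsm2 post_meas.aemeasurable).1 hA'
  have hint : ∫ x, (f (pPost x.1.1 x.1.2 x.2) * f (qPost x.1.1 x.1.2 x.2)) ∂(colMeas b ε) =
      ∫ x, (f x.1.1 * f x.1.2) ∂(colMeas b ε) := by
    have e1 := integral_map post_meas.aemeasurable hsm2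
    have e2 := integral_map measurable_fst.aemeasurable hsm1
    rw [map_eq b hε, e2] at e1
    exact e1.symm
  have hT : Integrable (fun x : (R3 × R3) × sphere (0 : R3) 1 =>
      f (pPost x.1.1 x.1.2 x.2) * f (qPost x.1.1 x.1.2 x.2) - f x.1.1 * f x.1.2) (colMeas b ε) :=
    Integrable.sub hA hB
  have hT0 : ∫ x, (f (pPost x.1.1 x.1.2 x.2) * f (qPost x.1.1 x.1.2 x.2) - f x.1.1 * f x.1.2)
      ∂(colMeas b ε) = 0 := by
    have := integral_sub hA hB
    simp only [Function.comp_apply] at this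
    rw [this, hint, sub_self]
  rw [colMeas, integrable_withDensity_iff_integrable_smul hd] at hT
  rw [colMeas, integral_withDensity_eq_integral_smul hd] at hT0
  simp only [hsm] at hT hT0
  rw [integral_prod _ hT, Measure.volume_eq_prod, integral_prod _ hT.integral_prod_left] at hT0
  unfold Qcoll
  rw [integral_const_mul]
  have : ∀ p q : R3, (if ε ≤ relMom p q then relMom p q ^ (2 - b) / (‖p‖ * ‖q‖) else 0) =
      WW b ε (p, q) := by
    intro p q
    unfold WW wt
    split_ifs <;> simp
  simp only [this]
  rw [hT0, mul_zero]
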